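/- arXiv:2002.03670 — 2 statements merged into one kernel-verified Lean document; each statement's English description precedes it below -/
import Mathlib

section
/- Let L ∈ ℝ^{m×m} and D ∈ ℝ^{k×k} be symmetric positive definite matrices and let U ∈ ℝ^{m×k}. Set L̂ := L + U D⁻¹ Uᵀ. Then L̂ is positive definite, the matrix D + Uᵀ L⁻¹ U is invertible, one has Uᵀ L̂⁻¹ U = D − D (D + Uᵀ L⁻¹ U)⁻¹ D, and consequently the matrix D − Uᵀ L̂⁻¹ U is invertible with inverse (D − Uᵀ L̂⁻¹ U)⁻¹ = D⁻¹ (D + Uᵀ L⁻¹ U) D⁻¹. -/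
open Matrix

/-- for symmetric positive definite `L ∈ ℝ^{m×m}`, `D ∈ ℝ^{k×k}` and
`U ∈ ℝ^{m×k}`, the matrix `L̂ = L + U D⁻¹ Uᵀ` is positive definite, `D + Uᵀ L⁻¹ U` is
invertible, `Uᵀ L̂⁻¹ U = D - D (D + Uᵀ L⁻¹ U)⁻¹ D`, and `D - Uᵀ L̂⁻¹ U` is invertible
with inverse `D⁻¹ (D + Uᵀ L⁻¹ U) D⁻¹`. -/
theorem schur_woodbury_identities
    {m k : ℕ}
    (L : Matrix (Fin m) (Fin m) ℝ) (hL : L.PosDef) (hLsymm : L.IsSymm)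
    (D : Matrix (Fin k) (Fin k) ℝ) (hD : D.PosDef) (hDsymm : D.IsSymm)
    (U : Matrix (Fin m) (Fin k) ℝ) :
    (L + U * D⁻¹ * Uᵀ).PosDef ∧
    IsUnit (D + Uᵀ * L⁻¹ * U) ∧
    Uᵀ * (L + U * D⁻¹ * Uᵀ)⁻¹ * U = D - D * (D + Uᵀ * L⁻¹ * U)⁻¹ * D ∧
    IsUnit (D - Uᵀ * (L + U * D⁻¹ * Uᵀ)⁻¹ * U) ∧
    (D - Uᵀ * (L + U * D⁻¹ * Uᵀ)⁻¹ * U)⁻¹ = D⁻¹ * (D + Uᵀ * L⁻¹ * U) * D⁻¹ := by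
  have hS : (D + Uᵀ * L⁻¹ * U).PosDef := by
    refine hD.add_posSemidef ?_
    have h := hL.inv.posSemidef.conjTranspose_mul_mul_same U
    rwa [conjTranspose_eq_transpose_of_trivial] at h
  have hLhat : (L + U * D⁻¹ * Uᵀ).PosDef := by
    refine hL.add_posSemidef ?_
    have h := hD.inv.posSemidef.mul_mul_conjTranspose_same U
    rwa [conjTranspose_eq_transpose_of_trivial] at h
  have hDd : IsUnit D.det := (isUnit_iff_isUnit_det D).1 hD.isUnit
  have hDD : D⁻¹⁻¹ = D := nonsing_inv_nonsing_inv D hDd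
  have hW := add_mul_mul_inv_eq_sub L U D⁻¹ Uᵀ hL.isUnit hD.inv.isUnit
    (by rw [hDD]; exact hS.isUnit)
  rw [hDD] at hW
  have key : Uᵀ * (L + U * D⁻¹ * Uᵀ)⁻¹ * U = D - D * (D + Uᵀ * L⁻¹ * U)⁻¹ * D := by
    have hSd : IsUnit (D + Uᵀ * L⁻¹ * U).det := (isUnit_iff_isUnit_det _).1 hS.isUnit
    have h1 : Uᵀ * (L + U * D⁻¹ * Uᵀ)⁻¹ * U = Uᵀ * L⁻¹ * U
        - (Uᵀ * L⁻¹ * U) * (D + Uᵀ * L⁻¹ * U)⁻¹ * (Uᵀ * L⁻¹ * U) := by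
      rw [hW]
      simp only [Matrix.mul_sub, Matrix.sub_mul, Matrix.mul_assoc]
    rw [h1]
    generalize hG : Uᵀ * L⁻¹ * U = G at hSd ⊢
    obtain ⟨S, hSG⟩ : ∃ S, S = D + G := ⟨_, rfl⟩
    rw [← hSG] at hSd ⊢
    obtain rfl : G = S - D := by rw [hSG]; abel
    rw [Matrix.sub_mul, mul_nonsing_inv S hSd, Matrix.sub_mul, Matrix.mul_sub (D * S⁻¹),
      nonsing_inv_mul_cancel_right _ _ hSd, Matrix.one_mul]
    abel
  have key2 : D - Uᵀ * (L + U * D⁻¹ * Uᵀ)⁻¹ * U = D * (D + Uᵀ * L⁻¹ * U)⁻¹ * D := by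
    rw [key]; abel
  refine ⟨hLhat, hS.isUnit, key, ?_, ?_⟩
  · rw [key2]
    exact (hD.isUnit.mul hS.inv.isUnit).mul hD.isUnit
  · rw [key2, Matrix.mul_inv_rev, Matrix.mul_inv_rev,
      nonsing_inv_nonsing_inv _ ((isUnit_iff_isUnit_det _).1 hS.isUnit), ← Matrix.mul_assoc D⁻¹]
end

section
/- Let G₁ and G₂ be finite weighted trees, each having at least one interior vertex and no vertices of degree two, with leaf enumerations v_1^1, …, v_k^1 and v_1^2, …, v_k^2 of the same length k. For j = 1, 2 let S_j := D̂_j − B_jᵀ L̂_j⁻¹ B_j be the Schur complement of the weighted Laplacian L(G_j) onto the leaves, taken with respect to the block form L(G_j) = [[D̂_j, −B_jᵀ],[−B_j, L̂_j]] given by the partition into leaves (in the given enumeration) and interior vertices. If S₁ = S₂, then there exists a graph isomorphism φ from G₁ onto G₂ with φ(v_i^1) = v_i^2 for all i = 1, …, k which maps every edge of G₁ to an edge of G₂ of the same weight. -/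
open Finset Matrix

/-- The weighted Laplacian of a graph `G` with edge weights `w`. -/
def weightedLaplacian {V : Type*} [Fintype V] [DecidableEq V]
    (G : SimpleGraph V) [DecidableRel G.Adj] (w : V → V → ℝ) : Matrix V V ℝ :=
  Matrix.of fun i j =>
    if i = j then ∑ k ∈ Finset.univ.filter (G.Adj i ·), w i k
    else if G.Adj i j then - w i j else 0

/-- The Schur complement of the weighted Laplacian of `G` onto the leaves, enumerated by
`v : Fin k → V`, with respect to the block decomposition `[[D̂, -Bᵀ], [-B, L̂]]` of the
Laplacian into leaves and interior vertices. -/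
noncomputable def leafSchurComplement {V : Type*} [Fintype V] [DecidableEq V]
    (G : SimpleGraph V) [DecidableRel G.Adj] (w : V → V → ℝ)
    {k : ℕ} (v : Fin k → V) : Matrix (Fin k) (Fin k) ℝ :=
  (Matrix.of fun i j => weightedLaplacian G w (v i) (v j)) -
    (Matrix.of fun (l : {u : V // G.degree u ≠ 1}) (i : Fin k) =>
      -(weightedLaplacian G w (l : V) (v i)))ᵀ *
    ((weightedLaplacian G w).submatrix
      (fun l : {u : V // G.degree u ≠ 1} => (l : V))
      (fun l : {u : V // G.degree u ≠ 1} => (l : V)))⁻¹ *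
    (Matrix.of fun (l : {u : V // G.degree u ≠ 1}) (i : Fin k) =>
      -(weightedLaplacian G w (l : V) (v i)))

/-- Cost of a walk. -/
def wCost {V : Type*} {G : SimpleGraph V} (r : V → V → ℝ) : ∀ {x y : V}, G.Walk x y → ℝ
  | _, _, .nil => 0
  | _, _, .cons (u := a) (v := b) _ p => r a b + wCost r p

/-- The metric/betweenness facts on a weighted tree. -/
structure TreeData {V : Type*} (G : SimpleGraph V) (w : V → V → ℝ) (d : V → V → ℝ)
    (B : V → V → V → Prop) : Prop where
  dsymm : ∀ x y, d x y = d y x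
  dself : ∀ x, d x x = 0
  dpos : ∀ x y, x ≠ y → 0 < d x y
  dadj : ∀ x a, G.Adj x a → d x a = (w x a)⁻¹
  bsymm : ∀ z x y, B z x y → B z y x
  bl : ∀ x y, B x x y
  badd : ∀ z x y, B z x y → d x z + d z y = d x y
  bsplit : ∀ z x y, B z x y → ∀ m, B z x m ∨ B z m y
  btrans : ∀ l i m j, B l i m → B m i j → B l i j
  dich : ∀ x a, G.Adj x a → ∀ z, B x z a ∨ B a z x
  bnb : ∀ x a b, G.Adj x a → G.Adj x b → a ≠ b → B x a b
  nbr : ∀ x i, x ≠ i → ∃ a, G.Adj x a ∧ B a x i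
  adjB : ∀ x y z, G.Adj x y → B z x y → z = x ∨ z = y

theorem wCost_append {V : Type*} {G : SimpleGraph V} (r : V → V → ℝ) {x y z : V}
    (p : G.Walk x y) (q : G.Walk y z) : wCost r (p.append q) = wCost r p + wCost r q := by
  induction p with
  | nil => simp [wCost]
  | cons h p ih => simp [wCost, ih, add_assoc]

theorem wCost_reverse {V : Type*} {G : SimpleGraph V} (r : V → V → ℝ)
    (hr : ∀ a b, r a b = r b a) {x y : V}
    (p : G.Walk x y) : wCost r p.reverse = wCost r p := by
  induction p with
  | nil => simp [wCost]
  | cons h p ih =>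
    rw [SimpleGraph.Walk.reverse_cons, wCost_append, ih]
    simp [wCost, hr, add_comm]

theorem wCost_nonneg {V : Type*} {G : SimpleGraph V} (r : V → V → ℝ)
    (hr : ∀ a b, G.Adj a b → 0 < r a b) {x y : V}
    (p : G.Walk x y) : 0 ≤ wCost r p := by
  induction p with
  | nil => simp [wCost]
  | cons h p ih => have := hr _ _ h; simp only [wCost]; linarith

theorem exists_treeData {V : Type*} (G : SimpleGraph V) (hG : G.IsTree) (w : V → V → ℝ)
    (hw : ∀ a b, w a b = w b a) (hpos : ∀ a b, G.Adj a b → 0 < w a b) :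
    ∃ d B, TreeData G w d B := by
  classical
  choose P hP hU using fun x y => hG.existsUnique_path x y
  simp only at hP hU
  have hr : ∀ a b, (fun a b => (w a b)⁻¹) a b = (fun a b => (w a b)⁻¹) b a := by
    intro a b; simp only [hw a b]
  have hr0 : ∀ a b, G.Adj a b → 0 < (fun a b => (w a b)⁻¹) a b := by
    intro a b h; simp only; exact inv_pos.2 (hpos a b h)
  have hsub : ∀ {x y} (p : G.Walk x y), (P x y).support ⊆ p.support := by
    intro x y p
    rw [← hU x y p.bypass p.bypass_isPath]
    exact p.support_bypass_subset_support
  have hrev : ∀ x y, (P x y).reverse = P y x := fun x y => hU _ _ _ (hP x y).reverse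
  have hspl : ∀ x y z, z ∈ (P x y).support → P x y = (P x z).append (P z y) := by
    intro x y z hz
    rw [← hU x z _ ((hP x y).takeUntil hz), ← hU z y _ ((hP x y).dropUntil hz)]
    exact ((P x y).take_spec hz).symm
  have hadj : ∀ x a (h : G.Adj x a), P x a = .cons h .nil := by
    intro x a h
    symm; apply hU
    simp [SimpleGraph.Walk.cons_isPath_iff, h.ne]
  have hnil : ∀ x, P x x = .nil := fun x => (hU x x _ (by simp)).symm
  refine ⟨fun x y => wCost (fun a b => (w a b)⁻¹) (P x y), fun z x y => z ∈ (P x y).support, ?_⟩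
  constructor
  · intro x y
    try simp only
    rw [← hrev x y, wCost_reverse _ hr]
  · intro x; simp [hnil, wCost]
  · intro x y hxy
    try simp only
    cases hc : P x y with
    | nil => exact absurd rfl hxy
    | cons h p =>
      simp only [wCost]
      have := hr0 _ _ h
      have := wCost_nonneg _ hr0 p
      try simp only at *
      linarith
  · intro x a h
    simp [hadj x a h, wCost]
  · intro z x y h
    try simp only at *
    rw [← hrev x y]; simpa using h
  · intro x y; simp
  · intro z x y h
    try simp only at *
    rw [hspl x y z h, wCost_append]
  · intro z x y h m
    have := hsub ((P x m).append (P m y)) h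
    simpa [SimpleGraph.Walk.mem_support_append_iff] using this
  · intro l i m j h1 h2
    try simp only at *
    rw [hspl i j m h2, SimpleGraph.Walk.mem_support_append_iff]
    exact Or.inl h1
  · intro x a h z
    by_cases hx : x ∈ (P z a).support
    · exact Or.inl hx
    · right
      have hx' : x ∉ (P a z).support := by
        rw [← hrev z a]; simpa using hx
      have : (SimpleGraph.Walk.cons h (P a z)).IsPath :=
        (SimpleGraph.Walk.cons_isPath_iff _ _).2 ⟨hP a z, hx'⟩
      have h2 := hU _ _ _ this
      try simp only
      rw [← hrev x z, ← h2]
      simp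
  · intro x a b ha hb hab
    have : (SimpleGraph.Walk.cons ha.symm (.cons hb .nil)).IsPath := by
      simp [SimpleGraph.Walk.cons_isPath_iff, hb.ne, ha.ne', hab]
    try simp only
    rw [← hU _ _ _ this]; simp
  · intro x i hxi
    try simp only
    cases hc : P x i with
    | nil => exact absurd rfl hxi
    | cons h p => exact ⟨_, h, by simp⟩
  · intro x y z h hz
    try simp only at hz
    rw [hadj x y h] at hz; simpa using hz

namespace TreeData

variable {V : Type*} {G : SimpleGraph V} {w d : V → V → ℝ} {B : V → V → V → Prop}

theorem dnonneg (T : TreeData G w d B) (x y : V) : 0 ≤ d x y := by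
  by_cases h : x = y
  · subst h; rw [T.dself]
  · exact (T.dpos x y h).le

theorem br (T : TreeData G w d B) (x y : V) : B y x y := T.bsymm _ _ _ (T.bl y x)

theorem excl (T : TreeData G w d B) {x a i : V} (h : x ≠ a) (h1 : B a x i) (h2 : B x a i) :
    False := by
  have e1 := T.badd _ _ _ h1
  have e2 := T.badd _ _ _ h2
  have := T.dpos x a h
  have := T.dsymm x a
  linarith

theorem nbr_unique (T : TreeData G w d B) {x a b i : V} (ha : G.Adj x a) (hb : G.Adj x b)
    (h1 : B a x i) (h2 : B b x i) : a = b := by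
  by_contra hab
  rcases T.bsplit _ _ _ (T.bnb x a b ha hb hab) i with h | h
  · exact T.excl ha.ne h1 h
  · exact T.excl hb.ne h2 (T.bsymm _ _ _ h)

theorem median_aux (T : TreeData G w d B) (i j : V) {l z : V} (p : G.Walk l z) (hz : z = i) :
    ∃ y, B y i j ∧ B y i l ∧ B y j l := by
  induction p with
  | nil => subst hz; exact ⟨_, T.bl _ _, T.bl _ _, T.br _ _⟩
  | @cons l l' z h p ih =>
    obtain ⟨y, h1, h2, h3⟩ := ih hz
    by_cases hi : B y i l
    · by_cases hj : B y j l
      · exact ⟨y, h1, hi, hj⟩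
      · have hy : y = l' := by
          rcases T.bsplit _ _ _ h3 l with h4 | h4
          · exact absurd h4 hj
          · rcases T.adjB _ _ _ h h4 with h5 | h5
            · subst h5; exact absurd (T.br _ _) hj
            · exact h5
        subst hy
        rcases T.dich l y h j with h4 | h4
        · exact ⟨l, T.bsymm _ _ _ (T.btrans _ _ _ _ h4 (T.bsymm _ _ _ h1)), T.br _ _, T.br _ _⟩
        · exact absurd h4 hj
    · have hy : y = l' := by
        rcases T.bsplit _ _ _ h2 l with h4 | h4
        · exact absurd h4 hi
        · rcases T.adjB _ _ _ h h4 with h5 | h5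
          · subst h5; exact absurd (T.br _ _) hi
          · exact h5
      subst hy
      rcases T.dich l y h i with h4 | h4
      · exact ⟨l, T.btrans _ _ _ _ h4 h1, T.br _ _, T.br _ _⟩
      · exact absurd h4 hi

theorem median (T : TreeData G w d B) (hG : G.IsTree) (i j l : V) :
    ∃ y, B y i j ∧ B y i l ∧ B y j l := by
  obtain ⟨p⟩ := hG.connected.preconnected l i
  exact T.median_aux i j p rfl

theorem tri (T : TreeData G w d B) (hG : G.IsTree) (x y z : V) : d x z ≤ d x y + d y z := by
  obtain ⟨m, h1, h2, h3⟩ := T.median hG x z y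
  have := T.badd _ _ _ h1
  have := T.badd _ _ _ h2
  have := T.badd _ _ _ h3
  have := T.dnonneg m y
  have := T.dsymm z m
  have := T.dsymm z y
  linarith

theorem three (T : TreeData G w d B) {x a b i j : V} (ha : G.Adj x a) (hb : G.Adj x b)
    (hab : a ≠ b) (hi : B a x i) (hj : B b x j) : B x i j := by
  rcases T.bsplit _ _ _ (T.bnb x a b ha hb hab) i with h | h
  · exact (T.excl ha.ne hi h).elim
  · rcases T.bsplit _ _ _ h j with h | h
    · exact h
    · exact (T.excl hb.ne hj (T.bsymm _ _ _ h)).elim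

theorem leaf_beyond [Fintype V] [DecidableRel G.Adj] (T : TreeData G w d B) (hG : G.IsTree)
    [Nontrivial V] (x y : V) : ∃ m, G.degree m = 1 ∧ B y x m := by
  classical
  obtain ⟨m, hm, hmax⟩ := Finset.exists_max_image (Finset.univ.filter fun m => B y x m)
    (fun m => d x m) ⟨y, by simpa using T.br x y⟩
  simp only [Finset.mem_filter, Finset.mem_univ, true_and] at hm hmax
  refine ⟨m, ?_, hm⟩
  by_contra hdeg
  have hpos : 0 < G.degree m := hG.connected.preconnected.degree_pos_of_nontrivial m
  have h2 : 1 < (G.neighborFinset m).card := by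
    rw [SimpleGraph.card_neighborFinset_eq_degree]; omega
  obtain ⟨a, ha, b, hb, hab⟩ := Finset.one_lt_card.1 h2
  rw [SimpleGraph.mem_neighborFinset] at ha hb
  have key : ∀ n, G.Adj m n → ¬ B m x n := by
    intro n hn hB
    have h3 := hmax n (T.btrans _ _ _ _ hm hB)
    have := T.badd _ _ _ hB
    have := T.dpos _ _ hn.ne
    linarith
  have ha' := (T.dich m a ha x).resolve_left (key a ha)
  have hb' := (T.dich m b hb x).resolve_left (key b hb)
  exact hab (T.nbr_unique ha hb (T.bsymm _ _ _ ha') (T.bsymm _ _ _ hb'))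

/-- interior vertices are medians of three leaves -/
theorem interior [Fintype V] [DecidableRel G.Adj] (T : TreeData G w d B) (hG : G.IsTree)
    [Nontrivial V] (x : V) (h1 : G.degree x ≠ 1) (h2 : G.degree x ≠ 2) :
    ∃ i j l, G.degree i = 1 ∧ G.degree j = 1 ∧ G.degree l = 1 ∧ B x i j ∧ B x i l ∧ B x j l := by
  classical
  have hpos : 0 < G.degree x := hG.connected.preconnected.degree_pos_of_nontrivial x
  have h3 : 2 < (G.neighborFinset x).card := by
    rw [SimpleGraph.card_neighborFinset_eq_degree]; omega
  obtain ⟨a, b, c, ha, hb, hc, hab, hac, hbc⟩ := Finset.two_lt_card_iff.1 h3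
  rw [SimpleGraph.mem_neighborFinset] at ha hb hc
  obtain ⟨i, hi, hi'⟩ := T.leaf_beyond hG x a
  obtain ⟨j, hj, hj'⟩ := T.leaf_beyond hG x b
  obtain ⟨l, hl, hl'⟩ := T.leaf_beyond hG x c
  exact ⟨i, j, l, hi, hj, hl, T.three ha hb hab hi' hj', T.three ha hc hac hi' hl',
    T.three hb hc hbc hj' hl'⟩

/-- distance from a point on a segment -/
theorem dist_max (T : TreeData G w d B) (hG : G.IsTree) {x i j : V} (h : B x i j) (m : V) :
    d x m = max (d i m - d x i) (d j m - d x j) := by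
  have t1 := T.tri hG i x m
  have t2 := T.tri hG j x m
  have s1 := T.dsymm i x
  have s2 := T.dsymm j x
  apply le_antisymm
  · rcases T.bsplit _ _ _ h m with h | h
    · have := T.badd _ _ _ h
      exact le_max_of_le_left (by linarith)
    · have := T.badd _ _ _ (T.bsymm _ _ _ h)
      exact le_max_of_le_right (by linarith)
  · exact max_le (by linarith) (by linarith)

theorem lap_dist [Fintype V] [DecidableEq V] [DecidableRel G.Adj] (T : TreeData G w d B)
    (hpos : ∀ a b, G.Adj a b → 0 < w a b) (x i : V) :
    ∑ a ∈ Finset.univ.filter (G.Adj x ·), w x a * (d x i - d a i) =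
      (if x = i then 0 else 2) - G.degree x := by
  classical
  have hterm : ∀ a, G.Adj x a → w x a * (d x i - d a i) = (if B a x i then 2 else 0) - 1 := by
    intro a ha
    have hw := hpos x a ha
    have hd := T.dadj x a ha
    split_ifs with h
    · have := T.badd _ _ _ h
      have e : d x i - d a i = (w x a)⁻¹ := by linarith
      rw [e, mul_inv_cancel₀ hw.ne']; norm_num
    · have h' := (T.dich x a ha i).resolve_right (fun h' => h (T.bsymm _ _ _ h'))
      have := T.badd _ _ _ (T.bsymm _ _ _ h')
      have := T.dsymm a x
      have e : d x i - d a i = - (w x a)⁻¹ := by linarith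
      rw [e, mul_neg, mul_inv_cancel₀ hw.ne']; norm_num
  rw [Finset.sum_congr rfl (fun a ha => hterm a (by simpa using ha)), Finset.sum_sub_distrib]
  have hc : (Finset.univ.filter (G.Adj x ·)).card = G.degree x := by
    rw [← SimpleGraph.card_neighborFinset_eq_degree]; congr 1; ext; simp
  congr 1
  · split_ifs with hxi
    · subst hxi
      apply Finset.sum_eq_zero
      intro a ha
      have ha : G.Adj x a := by simpa using ha
      rw [if_neg]
      intro hB
      exact T.excl ha.ne hB (T.br _ _)
    · obtain ⟨a, ha, hB⟩ := T.nbr x i hxi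
      rw [Finset.sum_eq_single a]
      · rw [if_pos hB]
      · intro b hb hba
        rw [if_neg]
        intro hB'
        exact hba (T.nbr_unique (by simpa using hb) ha hB' hB)
      · intro h; simp [ha] at h
  · simp [hc]

end TreeData

section Lap

variable {V : Type*} [Fintype V] [DecidableEq V] {G : SimpleGraph V} [DecidableRel G.Adj]
  {w : V → V → ℝ}

theorem lap_mulVec (u : V → ℝ) (x : V) :
    (weightedLaplacian G w *ᵥ u) x =
      ∑ a ∈ Finset.univ.filter (G.Adj x ·), w x a * (u x - u a) := by
  have h1 : ∀ a, weightedLaplacian G w x a * u a =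
      (if x = a then (∑ k ∈ Finset.univ.filter (G.Adj x ·), w x k) * u a else 0) -
      (if G.Adj x a then w x a * u a else 0) := by
    intro a
    simp only [weightedLaplacian, Matrix.of_apply]
    by_cases h : x = a
    · subst h; simp
    · by_cases h' : G.Adj x a <;> simp [h, h']
  simp only [Matrix.mulVec, dotProduct]
  rw [Finset.sum_congr rfl (fun a _ => h1 a), Finset.sum_sub_distrib]
  rw [← Finset.sum_filter (s := Finset.univ) (p := fun a => G.Adj x a)]
  simp only [mul_sub, Finset.sum_sub_distrib]
  simp [Finset.sum_mul]

theorem lap_symm (hw : ∀ a b, w a b = w b a) (x y : V) :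
    weightedLaplacian G w x y = weightedLaplacian G w y x := by
  by_cases h : x = y
  · subst h; rfl
  · simp [weightedLaplacian, h, Ne.symm h, G.adj_comm x y, hw x y]

theorem energy (hG : G.IsTree) (hw : ∀ a b, w a b = w b a)
    (hpos : ∀ a b, G.Adj a b → 0 < w a b) (u : V → ℝ)
    (h : ∀ x, u x * (weightedLaplacian G w *ᵥ u) x = 0) (x y : V) : u x = u y := by
  let c : V → V → ℝ := fun x a => if G.Adj x a then w x a else 0
  have hcs : ∀ x a, c x a = c a x := by
    intro x a; simp only [c, G.adj_comm x a, hw x a]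
  have hc0 : ∀ x a, 0 ≤ c x a := by
    intro x a; simp only [c]; split_ifs with h
    · exact (hpos _ _ h).le
    · exact le_rfl
  have h1 : ∑ x, ∑ a, c x a * (u x * (u x - u a)) = 0 := by
    apply Finset.sum_eq_zero
    intro x _
    rw [← h x, lap_mulVec, Finset.mul_sum, Finset.sum_filter]
    apply Finset.sum_congr rfl
    intro a _
    simp only [c]; split_ifs <;> ring
  have h2 : ∑ x, ∑ a, c x a * (u a * (u a - u x)) = 0 := by
    rw [Finset.sum_comm, ← h1]
    refine Finset.sum_congr rfl fun x _ => Finset.sum_congr rfl fun a _ => ?_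
    rw [hcs]
  have h3 : ∑ x, ∑ a, c x a * (u x - u a) ^ 2 = 0 := by
    rw [← add_zero (0 : ℝ)]
    nth_rewrite 1 [← h1]
    rw [← h2, ← Finset.sum_add_distrib]
    refine Finset.sum_congr rfl fun x _ => ?_
    rw [← Finset.sum_add_distrib]
    refine Finset.sum_congr rfl fun a _ => ?_
    ring
  have hn : ∀ x a, 0 ≤ c x a * (u x - u a) ^ 2 := fun x a => mul_nonneg (hc0 x a) (sq_nonneg _)
  have h4 : ∀ x a, G.Adj x a → u x = u a := by
    intro x a hxa
    have h5 := (Finset.sum_eq_zero_iff_of_nonneg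
      (fun x _ => Finset.sum_nonneg fun a _ => hn x a)).1 h3 x (Finset.mem_univ _)
    have h6 := (Finset.sum_eq_zero_iff_of_nonneg (fun a _ => hn x a)).1 h5 a (Finset.mem_univ _)
    simp only [c, if_pos hxa] at h6
    have := (mul_eq_zero.1 h6).resolve_left (hpos _ _ hxa).ne'
    have := pow_eq_zero_iff (two_ne_zero) |>.1 this
    linarith
  obtain ⟨p⟩ := hG.connected.preconnected x y
  induction p with
  | nil => rfl
  | cons h p ih => exact (h4 _ _ h).trans ih

theorem sum_split {k : ℕ} {v : Fin k → V} (hinj : Function.Injective v)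
    (hrange : Set.range v = {u : V | G.degree u = 1}) (f : V → ℝ) :
    ∑ x, f x = ∑ i, f (v i) + ∑ l : {u : V // G.degree u ≠ 1}, f l := by
  rw [← Fintype.sum_subtype_add_sum_subtype (fun u => G.degree u = 1) f]
  congr 1
  have e : Function.Bijective (fun i : Fin k => (⟨v i, by
      have : v i ∈ Set.range v := ⟨i, rfl⟩
      rw [hrange] at this; exact this⟩ : {u : V // G.degree u = 1})) := by
    constructor
    · intro i j h
      exact hinj (by simpa using h)
    · rintro ⟨u, hu⟩
      have : u ∈ Set.range v := by rw [hrange]; exact hu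
      obtain ⟨i, hi⟩ := this
      exact ⟨i, by simpa using hi⟩
  exact (Fintype.sum_bijective _ e _ _ (fun i => rfl)).symm

/-- interior block -/
abbrev intBlock (G : SimpleGraph V) [DecidableRel G.Adj] (w : V → V → ℝ) :
    Matrix {u : V // G.degree u ≠ 1} {u : V // G.degree u ≠ 1} ℝ :=
  (weightedLaplacian G w).submatrix
      (fun l : {u : V // G.degree u ≠ 1} => (l : V))
      (fun l : {u : V // G.degree u ≠ 1} => (l : V))

/-- coupling block -/
abbrev cplBlock (G : SimpleGraph V) [DecidableRel G.Adj] (w : V → V → ℝ) {k : ℕ}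
    (v : Fin k → V) : Matrix {u : V // G.degree u ≠ 1} (Fin k) ℝ :=
  Matrix.of fun (l : {u : V // G.degree u ≠ 1}) (i : Fin k) =>
      -(weightedLaplacian G w (l : V) (v i))

theorem intBlock_unit (hG : G.IsTree) (hw : ∀ a b, w a b = w b a)
    (hpos : ∀ a b, G.Adj a b → 0 < w a b) {k : ℕ} {v : Fin k → V}
    (hinj : Function.Injective v)
    (hrange : Set.range v = {u : V | G.degree u = 1}) (hk : 0 < k) :
    IsUnit (intBlock G w).det := by
  rw [isUnit_iff_ne_zero]
  intro hdet
  obtain ⟨g, hg0, hg⟩ := Matrix.exists_mulVec_eq_zero_iff.2 hdet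
  let u : V → ℝ := fun x => if h : G.degree x ≠ 1 then g ⟨x, h⟩ else 0
  have hv : ∀ i, G.degree (v i) = 1 := fun i => by
    have : v i ∈ Set.range v := ⟨i, rfl⟩
    rw [hrange] at this; exact this
  have hul : ∀ i, u (v i) = 0 := fun i => by simp [u, hv i]
  have hui : ∀ l : {u : V // G.degree u ≠ 1}, u l = g l := fun l => by
    simp only [u, dif_pos l.2]
  have hconst := energy hG hw hpos u (by
    intro x
    by_cases hx : G.degree x ≠ 1
    · have : (weightedLaplacian G w *ᵥ u) x = (intBlock G w *ᵥ g) ⟨x, hx⟩ := by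
        simp only [Matrix.mulVec, dotProduct]
        rw [sum_split hinj hrange]
        simp [hul, hui]
      rw [this, hg]; simp
    · simp [u, hx])
  apply hg0
  ext l
  rw [← hui l, hconst l (v ⟨0, hk⟩), hul]; rfl

/-- harmonic functions: Schur complement action -/
theorem schur_apply (hw : ∀ a b, w a b = w b a)
    {k : ℕ} {v : Fin k → V} (hinj : Function.Injective v)
    (hrange : Set.range v = {u : V | G.degree u = 1})
    (hunit : IsUnit (intBlock G w).det) (u : V → ℝ)
    (hu : ∀ x, G.degree x ≠ 1 → (weightedLaplacian G w *ᵥ u) x = 0) (i : Fin k) :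
    (leafSchurComplement G w v *ᵥ (u ∘ v)) i = (weightedLaplacian G w *ᵥ u) (v i) := by
  have h1 : intBlock G w *ᵥ (fun l => u l) = cplBlock G w v *ᵥ (u ∘ v) := by
    ext l
    have := hu l l.2
    simp only [Matrix.mulVec, dotProduct] at this ⊢
    rw [sum_split hinj hrange] at this
    simp only [Matrix.submatrix_apply, Matrix.of_apply, Function.comp, neg_mul,
      Finset.sum_neg_distrib]
    linarith
  have h2 : (intBlock G w)⁻¹ *ᵥ (cplBlock G w v *ᵥ (u ∘ v)) = fun l : {u : V // G.degree u ≠ 1} => u l := by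
    rw [← h1, Matrix.mulVec_mulVec, Matrix.nonsing_inv_mul _ hunit, Matrix.one_mulVec]
  change (((Matrix.of fun i j => weightedLaplacian G w (v i) (v j)) -
    (cplBlock G w v)ᵀ * (intBlock G w)⁻¹ * cplBlock G w v) *ᵥ (u ∘ v)) i = _
  rw [Matrix.sub_mulVec, ← Matrix.mulVec_mulVec, ← Matrix.mulVec_mulVec, h2]
  simp only [Pi.sub_apply, Matrix.mulVec, dotProduct, Matrix.of_apply, Matrix.transpose_apply]
  rw [sum_split hinj hrange]
  simp only [Function.comp, neg_mul, Finset.sum_neg_distrib, sub_neg_eq_add]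
  congr 1
  refine Finset.sum_congr rfl fun l _ => ?_
  rw [lap_symm hw]

theorem schur_ker (hG : G.IsTree) (hw : ∀ a b, w a b = w b a)
    (hpos : ∀ a b, G.Adj a b → 0 < w a b) {k : ℕ} {v : Fin k → V}
    (hinj : Function.Injective v)
    (hrange : Set.range v = {u : V | G.degree u = 1})
    (hunit : IsUnit (intBlock G w).det) (f : Fin k → ℝ)
    (hf : leafSchurComplement G w v *ᵥ f = 0) (i j : Fin k) : f i = f j := by
  classical
  let g := (intBlock G w)⁻¹ *ᵥ (cplBlock G w v *ᵥ f)
  have hv : ∀ i, G.degree (v i) = 1 := fun i => by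
    have : v i ∈ Set.range v := ⟨i, rfl⟩
    rw [hrange] at this; exact this
  haveI : Nonempty (Fin k) := ⟨i⟩
  let u : V → ℝ := fun x => if h : G.degree x ≠ 1 then g ⟨x, h⟩ else
    f (Function.invFun v x)
  have hul : ∀ i, u (v i) = f i := fun i => by
    simp [u, hv i, Function.leftInverse_invFun hinj i]
  have hui : ∀ l : {u : V // G.degree u ≠ 1}, u l = g l := fun l => by
    simp only [u, dif_pos l.2]
  have huv : u ∘ v = f := by ext i; exact hul i
  have hint : ∀ x, G.degree x ≠ 1 → (weightedLaplacian G w *ᵥ u) x = 0 := by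
    intro x hx
    have h1 : intBlock G w *ᵥ g = cplBlock G w v *ᵥ f := by
      simp only [g]
      rw [Matrix.mulVec_mulVec, Matrix.mul_nonsing_inv _ hunit, Matrix.one_mulVec]
    have h2 := congrFun h1 ⟨x, hx⟩
    simp only [Matrix.mulVec, dotProduct] at h2 ⊢
    rw [sum_split hinj hrange]
    simp only [hul, hui]
    simp only [Matrix.submatrix_apply, Matrix.of_apply, neg_mul,
      Finset.sum_neg_distrib] at h2
    linarith
  have hleaf : ∀ i, (weightedLaplacian G w *ᵥ u) (v i) = 0 := by
    intro i
    rw [← schur_apply hw hinj hrange hunit u hint i, huv, hf]; rfl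
  have := energy hG hw hpos u (by
    intro x
    by_cases hx : G.degree x = 1
    · have : x ∈ Set.range v := by rw [hrange]; exact hx
      obtain ⟨i, rfl⟩ := this
      rw [hleaf, mul_zero]
    · rw [hint x hx, mul_zero]) (v i) (v j)
  rwa [hul, hul] at this

theorem schur_dist {d : V → V → ℝ} {B : V → V → V → Prop} (T : TreeData G w d B)
    (hw : ∀ a b, w a b = w b a)
    (hpos : ∀ a b, G.Adj a b → 0 < w a b) {k : ℕ} {v : Fin k → V}
    (hinj : Function.Injective v)
    (hrange : Set.range v = {u : V | G.degree u = 1})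
    (hunit : IsUnit (intBlock G w).det) (i j m : Fin k) :
    (leafSchurComplement G w v *ᵥ (fun m => d (v m) (v j) - d (v m) (v i))) m =
      (if m = i then 2 else 0) - (if m = j then 2 else 0) := by
  have hL : ∀ x, (weightedLaplacian G w *ᵥ (fun x => d x (v j) - d x (v i))) x =
      (if x = v i then 2 else 0) - (if x = v j then 2 else 0) := by
    intro x
    rw [lap_mulVec]
    have h1 := T.lap_dist hpos x (v j)
    have h2 := T.lap_dist hpos x (v i)
    have h3 : ∑ a ∈ Finset.univ.filter (G.Adj x ·),
        w x a * (d x (v j) - d x (v i) - (d a (v j) - d a (v i))) =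
        ∑ a ∈ Finset.univ.filter (G.Adj x ·), w x a * (d x (v j) - d a (v j)) -
        ∑ a ∈ Finset.univ.filter (G.Adj x ·), w x a * (d x (v i) - d a (v i)) := by
      rw [← Finset.sum_sub_distrib]
      refine Finset.sum_congr rfl fun a _ => ?_
      ring
    rw [h3, h1, h2]
    split_ifs <;> ring
  have hv : ∀ i, G.degree (v i) = 1 := fun i => by
    have : v i ∈ Set.range v := ⟨i, rfl⟩
    rw [hrange] at this; exact this
  have := schur_apply hw hinj hrange hunit (fun x => d x (v j) - d x (v i)) (by
    intro x hx
    rw [hL, if_neg, if_neg, sub_zero]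
    · rintro rfl; exact hx (hv _)
    · rintro rfl; exact hx (hv _)) m
  rw [hL] at this
  simp only [hinj.eq_iff] at this
  exact this

end Lap

theorem dist_le_of_rel {V₁ V₂ : Type*} [Fintype V₁] {G₁ : SimpleGraph V₁} [DecidableRel G₁.Adj]
    {G₂ : SimpleGraph V₂} {w₁ d₁ B₁ w₂ d₂ B₂} (T₁ : TreeData G₁ w₁ d₁ B₁)
    (T₂ : TreeData G₂ w₂ d₂ B₂) (hG₁ : G₁.IsTree) (hG₂ : G₂.IsTree) [Nontrivial V₁]
    {k : ℕ} {v₁ : Fin k → V₁} {v₂ : Fin k → V₂}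
    (hrange₁ : Set.range v₁ = {u : V₁ | G₁.degree u = 1})
    {x x' : V₁} {y y' : V₂} (h : ∀ m, d₁ x (v₁ m) = d₂ y (v₂ m))
    (h' : ∀ m, d₁ x' (v₁ m) = d₂ y' (v₂ m)) : d₁ x x' ≤ d₂ y y' := by
  obtain ⟨m, hm, hB⟩ := T₁.leaf_beyond hG₁ x x'
  have : m ∈ Set.range v₁ := by rw [hrange₁]; exact hm
  obtain ⟨i, rfl⟩ := this
  have := T₁.badd _ _ _ hB
  have := T₂.tri hG₂ y y' (v₂ i)
  rw [← h, ← h'] at this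
  linarith

theorem exists_rel {V₁ V₂ : Type*} [Fintype V₁] {G₁ : SimpleGraph V₁} [DecidableRel G₁.Adj]
    {G₂ : SimpleGraph V₂} {w₁ d₁ B₁ w₂ d₂ B₂} (T₁ : TreeData G₁ w₁ d₁ B₁)
    (T₂ : TreeData G₂ w₂ d₂ B₂) (hG₁ : G₁.IsTree) (hG₂ : G₂.IsTree) [Nontrivial V₁]
    {k : ℕ} {v₁ : Fin k → V₁} {v₂ : Fin k → V₂}
    (hrange₁ : Set.range v₁ = {u : V₁ | G₁.degree u = 1})
    (hdeg₁ : ∀ u, G₁.degree u ≠ 2)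
    (hd : ∀ i j, d₁ (v₁ i) (v₁ j) = d₂ (v₂ i) (v₂ j)) (x : V₁) :
    ∃ y, ∀ m, d₁ x (v₁ m) = d₂ y (v₂ m) := by
  by_cases hx : G₁.degree x = 1
  · have : x ∈ Set.range v₁ := by rw [hrange₁]; exact hx
    obtain ⟨i, rfl⟩ := this
    exact ⟨v₂ i, hd i⟩
  · obtain ⟨i, j, l, hi, hj, hl, hij, hil, hjl⟩ := T₁.interior hG₁ x hx (hdeg₁ x)
    have hv : ∀ u, G₁.degree u = 1 → ∃ i, v₁ i = u := by
      intro u hu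
      have : u ∈ Set.range v₁ := by rw [hrange₁]; exact hu
      exact this
    obtain ⟨i, rfl⟩ := hv i hi
    obtain ⟨j, rfl⟩ := hv j hj
    obtain ⟨l, rfl⟩ := hv l hl
    obtain ⟨y, yij, yil, yjl⟩ := T₂.median hG₂ (v₂ i) (v₂ j) (v₂ l)
    have a1 := T₁.badd _ _ _ hij
    have a2 := T₁.badd _ _ _ hil
    have a3 := T₁.badd _ _ _ hjl
    have b1 := T₂.badd _ _ _ yij
    have b2 := T₂.badd _ _ _ yil
    have b3 := T₂.badd _ _ _ yjl
    have s1 := T₁.dsymm x (v₁ i)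
    have s2 := T₁.dsymm x (v₁ j)
    have s3 := T₂.dsymm y (v₂ i)
    have s4 := T₂.dsymm y (v₂ j)
    have e1 := hd i j
    have e2 := hd i l
    have e3 := hd j l
    have f1 : d₁ x (v₁ i) = d₂ y (v₂ i) := by linarith
    have f2 : d₁ x (v₁ j) = d₂ y (v₂ j) := by linarith
    refine ⟨y, fun m => ?_⟩
    rw [T₁.dist_max hG₁ hij, T₂.dist_max hG₂ yij, f1, f2, hd, hd]

theorem adj_of_iso {V₁ V₂ : Type*} {G₁ : SimpleGraph V₁}
    {G₂ : SimpleGraph V₂} {w₁ d₁ B₁ w₂ d₂ B₂} (T₁ : TreeData G₁ w₁ d₁ B₁)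
    (T₂ : TreeData G₂ w₂ d₂ B₂) (φ : V₁ ≃ V₂) (h : ∀ x y, d₂ (φ x) (φ y) = d₁ x y)
    {x y : V₁} (hxy : G₁.Adj x y) : G₂.Adj (φ x) (φ y) := by
  obtain ⟨a, ha, hB⟩ := T₂.nbr (φ x) (φ y) (fun e => hxy.ne (φ.injective e))
  obtain ⟨z, rfl⟩ := φ.surjective a
  by_cases hzy : z = y
  · rwa [← hzy]
  exfalso
  have hzx : x ≠ z := fun e => ha.ne (by rw [e])
  have e := T₂.badd _ _ _ hB
  rw [h, h, h] at e
  have p1 := T₁.dpos _ _ hzx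
  have p2 := T₁.dpos _ _ hzy
  have s1 := T₁.dsymm x z
  have s2 := T₁.dsymm x y
  rcases T₁.dich x y hxy z with h1 | h1
  · have := T₁.badd _ _ _ h1; linarith
  · have := T₁.badd _ _ _ h1; linarith

theorem nontrivial_of_pos {V : Type*} [Fintype V] {G : SimpleGraph V} [DecidableRel G.Adj]
    {k : ℕ} {v : Fin k → V}
    (hrange : Set.range v = {u : V | G.degree u = 1}) (hk : 0 < k) : Nontrivial V := by
  have h : G.degree (v ⟨0, hk⟩) = 1 := by
    have : v ⟨0, hk⟩ ∈ Set.range v := ⟨_, rfl⟩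
    rw [hrange] at this; exact this
  obtain ⟨b, hb⟩ := (G.degree_pos_iff_exists_adj _).1 (by omega : 0 < G.degree (v ⟨0, hk⟩))
  exact ⟨_, _, hb.ne⟩

theorem subsingleton_of_zero {V : Type*} [Fintype V] {G : SimpleGraph V} [DecidableRel G.Adj]
    (hG : G.IsTree) {v : Fin 0 → V}
    (hrange : Set.range v = {u : V | G.degree u = 1}) : Subsingleton V := by
  by_contra h
  rw [not_subsingleton_iff_nontrivial] at h
  obtain ⟨u, hu⟩ := hG.exists_vert_degree_one_of_nontrivial
  have : u ∈ Set.range v := by rw [hrange]; exact hu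
  obtain ⟨i, _⟩ := this
  exact i.elim0

/-- two finite weighted trees, each with at least one interior vertex and
no vertices of degree two, whose weighted Laplacians have equal Schur complements onto
the (enumerated) leaves, are isomorphic via a weight-preserving graph isomorphism
matching the leaf enumerations. -/
theorem weighted_trees_with_equal_schur_complements_isomorphic
    {V₁ V₂ : Type*} [Fintype V₁] [DecidableEq V₁] [Fintype V₂] [DecidableEq V₂]
    (G₁ : SimpleGraph V₁) [DecidableRel G₁.Adj] (htree₁ : G₁.IsTree)
    (G₂ : SimpleGraph V₂) [DecidableRel G₂.Adj] (htree₂ : G₂.IsTree)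
    (hint₁ : ∃ u : V₁, G₁.degree u ≠ 1) (hint₂ : ∃ u : V₂, G₂.degree u ≠ 1)
    (hdeg₁ : ∀ u : V₁, G₁.degree u ≠ 2) (hdeg₂ : ∀ u : V₂, G₂.degree u ≠ 2)
    (w₁ : V₁ → V₁ → ℝ) (hw₁ : ∀ a b, w₁ a b = w₁ b a)
    (hpos₁ : ∀ a b, G₁.Adj a b → 0 < w₁ a b)
    (w₂ : V₂ → V₂ → ℝ) (hw₂ : ∀ a b, w₂ a b = w₂ b a)
    (hpos₂ : ∀ a b, G₂.Adj a b → 0 < w₂ a b)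
    (k : ℕ)
    (v₁ : Fin k → V₁) (hinj₁ : Function.Injective v₁)
    (hrange₁ : Set.range v₁ = {u : V₁ | G₁.degree u = 1})
    (v₂ : Fin k → V₂) (hinj₂ : Function.Injective v₂)
    (hrange₂ : Set.range v₂ = {u : V₂ | G₂.degree u = 1})
    (hS : leafSchurComplement G₁ w₁ v₁ = leafSchurComplement G₂ w₂ v₂) :
    ∃ φ : G₁ ≃g G₂, (∀ i : Fin k, φ (v₁ i) = v₂ i) ∧
      ∀ a b : V₁, G₁.Adj a b → w₂ (φ a) (φ b) = w₁ a b := by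
  classical
  rcases Nat.eq_zero_or_pos k with rfl | hk
  · haveI := subsingleton_of_zero htree₁ hrange₁
    haveI := subsingleton_of_zero htree₂ hrange₂
    obtain ⟨a, _⟩ := hint₁
    obtain ⟨b, _⟩ := hint₂
    refine ⟨⟨⟨fun _ => b, fun _ => a, fun _ => Subsingleton.elim _ _,
      fun _ => Subsingleton.elim _ _⟩, ?_⟩, fun i => i.elim0, ?_⟩
    · intro x y
      constructor
      · intro h; exact absurd rfl h.ne
      · intro h; exact absurd (Subsingleton.elim _ _) h.ne
    · intro x y h
      exact absurd (Subsingleton.elim _ _) h.ne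
  haveI := nontrivial_of_pos hrange₁ hk
  haveI := nontrivial_of_pos hrange₂ hk
  obtain ⟨d₁, B₁, T₁⟩ := exists_treeData G₁ htree₁ w₁ hw₁ hpos₁
  obtain ⟨d₂, B₂, T₂⟩ := exists_treeData G₂ htree₂ w₂ hw₂ hpos₂
  have hu₁ := intBlock_unit htree₁ hw₁ hpos₁ hinj₁ hrange₁ hk
  have hu₂ := intBlock_unit htree₂ hw₂ hpos₂ hinj₂ hrange₂ hk
  have hd : ∀ i j, d₁ (v₁ i) (v₁ j) = d₂ (v₂ i) (v₂ j) := by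
    intro i j
    have h1 : leafSchurComplement G₂ w₂ v₂ *ᵥ
        (fun m => d₁ (v₁ m) (v₁ j) - d₁ (v₁ m) (v₁ i)) =
        leafSchurComplement G₂ w₂ v₂ *ᵥ
        (fun m => d₂ (v₂ m) (v₂ j) - d₂ (v₂ m) (v₂ i)) := by
      ext m
      rw [schur_dist T₂ hw₂ hpos₂ hinj₂ hrange₂ hu₂, ← hS,
        schur_dist T₁ hw₁ hpos₁ hinj₁ hrange₁ hu₁]
    have h2 := schur_ker htree₂ hw₂ hpos₂ hinj₂ hrange₂ hu₂ _
      (by rw [Matrix.mulVec_sub, h1, sub_self] :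
        leafSchurComplement G₂ w₂ v₂ *ᵥ
        ((fun m => d₁ (v₁ m) (v₁ j) - d₁ (v₁ m) (v₁ i)) -
        (fun m => d₂ (v₂ m) (v₂ j) - d₂ (v₂ m) (v₂ i))) = 0) i j
    simp only [Pi.sub_apply, T₁.dself, T₂.dself] at h2
    have := T₁.dsymm (v₁ i) (v₁ j)
    have := T₂.dsymm (v₂ i) (v₂ j)
    linarith
  choose f hf using exists_rel T₁ T₂ htree₁ htree₂ hrange₁ hdeg₁ hd
  choose g hg using exists_rel T₂ T₁ htree₂ htree₁ hrange₂ hdeg₂ (fun i j => (hd i j).symm)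
  have key : ∀ {x x' : V₁} {y y' : V₂}, (∀ m, d₁ x (v₁ m) = d₂ y (v₂ m)) →
      (∀ m, d₁ x' (v₁ m) = d₂ y' (v₂ m)) → d₁ x x' = d₂ y y' := by
    intro x x' y y' h h'
    exact le_antisymm (dist_le_of_rel T₁ T₂ htree₁ htree₂ hrange₁ h h')
      (dist_le_of_rel T₂ T₁ htree₂ htree₁ hrange₂ (fun m => (h m).symm) (fun m => (h' m).symm))
  have hgf : ∀ x, g (f x) = x := by
    intro x
    by_contra hne
    have h1 := T₁.dpos _ _ hne
    rw [key (fun m => (hg (f x) m).symm) (hf x), T₂.dself] at h1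
    exact lt_irrefl _ h1
  have hfu : ∀ x y, (∀ m, d₁ x (v₁ m) = d₂ y (v₂ m)) → f x = y := by
    intro x y h
    by_contra hne
    have h1 := T₂.dpos _ _ hne
    rw [← key (hf x) h, T₁.dself] at h1
    exact lt_irrefl _ h1
  have hfg : ∀ y, f (g y) = y := fun y => hfu _ _ (fun m => (hg y m).symm)
  let φ : V₁ ≃ V₂ := ⟨f, g, hgf, hfg⟩
  have hiso : ∀ x y, d₂ (φ x) (φ y) = d₁ x y := fun x y => (key (hf x) (hf y)).symm
  have hiso' : ∀ x y, d₁ (φ.symm x) (φ.symm y) = d₂ x y := fun x y => by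
    rw [← hiso]; simp
  have hadj : ∀ {x y}, G₂.Adj (φ x) (φ y) ↔ G₁.Adj x y := by
    intro x y
    constructor
    · intro h
      simpa using adj_of_iso T₂ T₁ φ.symm hiso' h
    · exact adj_of_iso T₁ T₂ φ hiso
  refine ⟨⟨φ, hadj⟩, fun i => hfu _ _ (hd i), fun a b h => ?_⟩
  have e := hiso a b
  rw [T₁.dadj _ _ h, T₂.dadj _ _ (hadj.2 h)] at e
  exact inv_injective e
end
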